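/- For all f, g in Thompson's group F, the element f⁻¹ ∘ g belongs to the subgroup H₂ if and only if p_f = p_g. Consequently the map [f] ↦ p_f is a well-defined bijection from the left coset space F/H₂ onto Ω₂ = {p_f : f ∈ F}. -/

import Mathlib

open Set MeasureTheory Filter Topology

/-- The binary Cantor space. -/
abbrev CantorC : Type := ℕ → Bool

/-- Finite binary words. -/
abbrev BWord : Type := List Bool

/-- Prepend a finite word to an infinite binary sequence. -/
def wordApp (w : BWord) (x : CantorC) : CantorC := fun n =>
  if h : n < w.length then w.get ⟨n, h⟩ else x (n - w.length)

/-- The cylinder of sequences beginning with the word `w`. -/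
def cyl (w : BWord) : Set CantorC := Set.range (wordApp w)

/-- `J` is a code: both the α-cylinders and the β-cylinders form a partition of the
Cantor space (every point lies in the cylinder of exactly one pair). -/
def IsCode (J : Finset (BWord × BWord)) : Prop :=
  (∀ x : CantorC, ∃! p : BWord × BWord, p ∈ J ∧ x ∈ cyl p.1) ∧
  (∀ x : CantorC, ∃! p : BWord × BWord, p ∈ J ∧ x ∈ cyl p.2)

/-- `J` is order preserving: α ≺ α' lexicographically iff β ≺ β' lexicographically. -/
def OrdPres (J : Finset (BWord × BWord)) : Prop :=
  ∀ p ∈ J, ∀ q ∈ J, (List.Lex (· < ·) p.1 q.1 ↔ List.Lex (· < ·) p.2 q.2)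

/-- The bijection `g` is induced by the code `J` : it maps `β·x` to `α·x`. -/
def InducedBy (J : Finset (BWord × BWord)) (g : Equiv.Perm CantorC) : Prop :=
  ∀ p ∈ J, ∀ x : CantorC, g (wordApp p.2 x) = wordApp p.1 x

/-- `J` is an order-preserving code inducing the bijection `g`. -/
def IsCodeFor (J : Finset (BWord × BWord)) (g : Equiv.Perm CantorC) : Prop :=
  IsCode J ∧ OrdPres J ∧ InducedBy J g

/-- Membership in (the realization on the Cantor space of) Thompson's group `F`. -/
def InF (g : Equiv.Perm CantorC) : Prop := ∃ J, IsCodeFor J g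

/-- The pair `(α, β)` has `|α| ≡ |β| (mod 2)`. -/
def EvenPair (p : BWord × BWord) : Prop := p.1.length % 2 = p.2.length % 2

/-- Membership in the subgroup `H₂` : some order-preserving code for `g` has all
pairs of even length difference. -/
def InH2 (g : Equiv.Perm CantorC) : Prop :=
  ∃ J, IsCodeFor J g ∧ ∀ p ∈ J, EvenPair p

/-- The union of the α-cylinders over pairs of even length difference. -/
def pSet (J : Finset (BWord × BWord)) : Set CantorC :=
  {x | ∃ p ∈ J, EvenPair p ∧ x ∈ cyl p.1}

/-- The union of the β-cylinders over pairs of even length difference. -/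
def eSet (J : Finset (BWord × BWord)) : Set CantorC :=
  {x | ∃ p ∈ J, EvenPair p ∧ x ∈ cyl p.2}

/-- `p_f` : for `f ∈ F` this equals `pSet J` for any (equivalently, every)
order-preserving code `J` for `f`. -/
def pF (g : Equiv.Perm CantorC) : Set CantorC :=
  ⋃ J ∈ {J : Finset (BWord × BWord) | IsCodeFor J g}, pSet J

/-- `E_f` : for `f ∈ F` this equals `eSet J` for any (equivalently, every)
order-preserving code `J` for `f`. -/
def EF (g : Equiv.Perm CantorC) : Set CantorC :=
  ⋃ J ∈ {J : Finset (BWord × BWord) | IsCodeFor J g}, eSet J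

/-- `Ω₂ = {p_f : f ∈ F}`. -/
def Omega2 : Set (Set CantorC) := {p | ∃ g, InF g ∧ pF g = p}

/-- The action `f · p = f(p ∩ E_f) ∪ f((C ∖ p) ∩ (C ∖ E_f))`. -/
def actF (g : Equiv.Perm CantorC) (p : Set CantorC) : Set CantorC :=
  g '' (p ∩ EF g) ∪ g '' (pᶜ ∩ (EF g)ᶜ)

open Classical in
/-- `T(p)` as a Boolean-valued characteristic function: `T(p) w = true` iff the
cylinder of `w` meets `p`. -/
noncomputable def Tb (p : Set CantorC) : BWord → Bool :=
  fun w => if (cyl w ∩ p).Nonempty then true else false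

/-- The embedding `p ↦ (T(p), T(C ∖ p))`. -/
noncomputable def embedT (p : Set CantorC) : (BWord → Bool) × (BWord → Bool) :=
  (Tb p, Tb pᶜ)

/-- `Ω̄₂` : the closure of the image of `Ω₂` under the embedding. -/
noncomputable def OmegaBar : Set ((BWord → Bool) × (BWord → Bool)) :=
  closure (embedT '' Omega2)

/-- Thompson's group `F`, as a subgroup of the permutation group of the Cantor space.
Since `{g | InF g}` is a subgroup (Statement 0), its closure equals itself. -/
def FGrp : Subgroup (Equiv.Perm CantorC) := Subgroup.closure {g | InF g}

/-- The subgroup `H₂` of `F`. Since `{g | InH2 g}` is a subgroup (Statement 4),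
its closure equals itself. -/
def H2Sub : Subgroup FGrp := Subgroup.closure {g : FGrp | InH2 (g : Equiv.Perm CantorC)}

theorem wordApp_nil (x : CantorC) : wordApp [] x = x := by
  funext n; simp [wordApp]

theorem wordApp_append (u v : BWord) (x : CantorC) :
    wordApp (u ++ v) x = wordApp u (wordApp v x) := by
  funext n
  simp only [wordApp, List.length_append, List.get_eq_getElem]
  by_cases h₁ : n < u.length
  · simp [h₁, Nat.lt_add_right]
  · by_cases h₂ : n - u.length < v.length
    · have h₃ : n < u.length + v.length := by omega
      simp [h₁, h₂, h₃, List.getElem_append_right (Nat.le_of_not_lt h₁)]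
    · have h₃ : ¬ n < u.length + v.length := by omega
      simp only [h₁, h₂, h₃, dite_false]
      congr 1
      omega

theorem wordApp_cons (a : Bool) (u : BWord) (x : CantorC) :
    wordApp (a :: u) x = wordApp [a] (wordApp u x) :=
  wordApp_append [a] u x

theorem wordApp_singleton_zero (a : Bool) (x : CantorC) : wordApp [a] x 0 = a := by
  simp [wordApp]

theorem wordApp_singleton_succ (a : Bool) (x : CantorC) (n : ℕ) :
    wordApp [a] x (n + 1) = x n := by
  simp [wordApp]

theorem wordApp_singleton_inj {a b : Bool} {x y : CantorC} :
    wordApp [a] x = wordApp [b] y ↔ a = b ∧ x = y := by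
  refine ⟨fun h => ⟨?_, ?_⟩, fun h => by rw [h.1, h.2]⟩
  · simpa only [wordApp_singleton_zero] using congrFun h 0
  · funext n
    simpa only [wordApp_singleton_succ] using congrFun h (n + 1)

theorem wordApp_injective (u : BWord) : Function.Injective (wordApp u) := by
  induction u with
  | nil => intro x y h; simpa only [wordApp_nil] using h
  | cons a u ih =>
    intro x y h
    rw [wordApp_cons, wordApp_cons a u y, wordApp_singleton_inj] at h
    exact ih h.2

theorem wordApp_ofFn (x : CantorC) (N : ℕ) :
    wordApp (List.ofFn fun i : Fin N => x i) (fun n => x (n + N)) = x := by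
  funext n
  by_cases h : n < N
  · simp [wordApp, h]
  · simp [wordApp, h, Nat.sub_add_cancel (Nat.le_of_not_lt h)]

/-- Words whose cylinders meet are comparable for the prefix order. -/
theorem prefix_or_prefix_of_wordApp_eq {u v : BWord} {x y : CantorC}
    (h : wordApp u x = wordApp v y) : u <+: v ∨ v <+: u := by
  induction u generalizing v with
  | nil => exact Or.inl List.nil_prefix
  | cons a u ih =>
    cases v with
    | nil => exact Or.inr List.nil_prefix
    | cons b v =>
      rw [wordApp_cons, wordApp_cons b, wordApp_singleton_inj] at h
      simpa [List.cons_prefix_cons, h.1] using ih h.2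

theorem eq_nil_of_forall_wordApp {u : BWord} (h : ∀ x, wordApp u x = x) : u = [] := by
  cases u with
  | nil => rfl
  | cons a u =>
    have h₁ := congrFun (h fun _ => !a) 0
    rw [wordApp_cons, wordApp_singleton_zero] at h₁
    simp at h₁

theorem eq_of_forall_wordApp_eq {u v : BWord} (h : ∀ x, wordApp u x = wordApp v x) : u = v := by
  rcases prefix_or_prefix_of_wordApp_eq (h fun _ => true) with ⟨w, rfl⟩ | ⟨w, rfl⟩
  · have : w = [] := eq_nil_of_forall_wordApp fun x =>
      wordApp_injective u (by rw [h x, wordApp_append])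
    simp [this]
  · have : w = [] := eq_nil_of_forall_wordApp fun x =>
      wordApp_injective v (by rw [← h x, wordApp_append])
    simp [this]

theorem isOpen_cyl (u : BWord) : IsOpen (cyl u) := by
  have : cyl u = ⋂ i : Fin u.length, (fun x : CantorC => x i) ⁻¹' {u.get i} := by
    ext x
    simp only [cyl, mem_range, mem_iInter, mem_preimage, mem_singleton_iff]
    constructor
    · rintro ⟨y, rfl⟩ i
      simp [wordApp]
    · intro h
      refine ⟨fun n => x (n + u.length), ?_⟩
      have h' : u = List.ofFn fun i : Fin u.length => x i := by
        simp only [h, List.ofFn_get]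
      have := wordApp_ofFn x u.length
      rwa [← h'] at this
  rw [this]
  exact isOpen_iInter_of_finite fun i =>
    (isOpen_discrete _).preimage (continuous_apply _)

theorem toLex_wordApp_singleton_lt {a b : Bool} {x y : CantorC} :
    toLex (wordApp [a] x) < toLex (wordApp [b] y) ↔ a < b ∨ a = b ∧ toLex x < toLex y := by
  constructor
  · rintro ⟨n, h₁, h₂⟩
    cases n with
    | zero => exact Or.inl (by simpa [wordApp] using h₂)
    | succ n =>
      refine Or.inr ⟨by simpa [wordApp] using h₁ 0 n.succ_pos, n, fun j hj => ?_, ?_⟩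
      · simpa [wordApp] using h₁ (j + 1) (Nat.succ_lt_succ hj)
      · simpa [wordApp] using h₂
  · rintro (h | ⟨rfl, n, h₁, h₂⟩)
    · exact ⟨0, fun j hj => absurd hj (Nat.not_lt_zero j), by simpa [wordApp] using h⟩
    · refine ⟨n + 1, fun j hj => ?_, by simpa [wordApp] using h₂⟩
      cases j with
      | zero => simp [wordApp]
      | succ j => simpa [wordApp] using h₁ j (Nat.lt_of_succ_lt_succ hj)

theorem toLex_wordApp_lt_wordApp_left (u : BWord) {x y : CantorC} :
    toLex (wordApp u x) < toLex (wordApp u y) ↔ toLex x < toLex y := by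
  induction u with
  | nil => simp only [wordApp_nil]
  | cons a u ih =>
    rw [wordApp_cons, wordApp_cons a u y, toLex_wordApp_singleton_lt, ih]
    simp

/-- For incomparable words, the lexicographic order is that of any points of their cylinders. -/
theorem lex_iff_toLex_wordApp_lt {u v : BWord} (huv : ¬ u <+: v) (hvu : ¬ v <+: u)
    (x y : CantorC) :
    List.Lex (· < ·) u v ↔ toLex (wordApp u x) < toLex (wordApp v y) := by
  induction u generalizing v with
  | nil => exact absurd List.nil_prefix huv
  | cons a u ih =>
    cases v with
    | nil => exact absurd List.nil_prefix hvu
    | cons b v =>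
      rw [wordApp_cons, wordApp_cons b, toLex_wordApp_singleton_lt, List.cons_lex_cons_iff]
      refine or_congr Iff.rfl (and_congr_right ?_)
      rintro rfl
      simp only [List.cons_prefix_cons, true_and] at huv hvu
      exact ih huv hvu

theorem exists_mem_cyl_of_prefix {u v : BWord} (h : u <+: v) :
    ∃ x : CantorC, x ∈ cyl u ∧ x ∈ cyl v := by
  obtain ⟨w, rfl⟩ := h
  exact ⟨wordApp (u ++ w) fun _ => true, ⟨_, (wordApp_append _ _ _).symm⟩, _, rfl⟩

/-- If the cylinders of the words `φ p`, `p ∈ J`, partition the Cantor space, then distinct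
elements of `J` have incomparable words. -/
theorem not_prefix_of_existsUnique {J : Finset (BWord × BWord)} {φ : BWord × BWord → BWord}
    (hJ : ∀ x : CantorC, ∃! p, p ∈ J ∧ x ∈ cyl (φ p)) {p q : BWord × BWord}
    (hp : p ∈ J) (hq : q ∈ J) (hpq : p ≠ q) : ¬ φ p <+: φ q := fun h => by
  obtain ⟨x, hx₁, hx₂⟩ := exists_mem_cyl_of_prefix h
  exact hpq ((hJ x).unique ⟨hp, hx₁⟩ ⟨hq, hx₂⟩)

/-- `g` replaces the prefix `p.2` by the prefix `p.1`. -/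
def IsLocalPair (g : Equiv.Perm CantorC) (p : BWord × BWord) : Prop :=
  ∀ y, g (wordApp p.2 y) = wordApp p.1 y

/-- Near `x`, `g` replaces some prefix by a prefix whose length has the same parity. -/
def EvenAt (g : Equiv.Perm CantorC) (x : CantorC) : Prop :=
  ∃ p, IsLocalPair g p ∧ x ∈ cyl p.2 ∧ EvenPair p

/-- `g` replaces prefixes near every point. -/
def IsLocallyPrefix (g : Equiv.Perm CantorC) : Prop :=
  ∀ x, ∃ p, IsLocalPair g p ∧ x ∈ cyl p.2

/-- `g` is strictly increasing for the lexicographic order. -/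
def LexStrictMono (g : Equiv.Perm CantorC) : Prop :=
  ∀ x y, toLex x < toLex y → toLex (g x) < toLex (g y)

theorem IsLocalPair.append {g : Equiv.Perm CantorC} {p : BWord × BWord}
    (h : IsLocalPair g p) (w : BWord) : IsLocalPair g (p.1 ++ w, p.2 ++ w) := fun y => by
  simp only [wordApp_append, h _]

theorem IsLocalPair.evenPair_iff {g : Equiv.Perm CantorC} {p q : BWord × BWord}
    (hp : IsLocalPair g p) (hq : IsLocalPair g q) {x : CantorC}
    (hxp : x ∈ cyl p.2) (hxq : x ∈ cyl q.2) : EvenPair p ↔ EvenPair q := by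
  have aux : ∀ {p q : BWord × BWord}, IsLocalPair g p → IsLocalPair g q → p.2 <+: q.2 →
      (EvenPair p ↔ EvenPair q) := by
    rintro p ⟨a, _⟩ hp hq ⟨w, rfl⟩
    obtain rfl : a = p.1 ++ w := eq_of_forall_wordApp_eq fun y =>
      (hq y).symm.trans (hp.append w y)
    simp only [EvenPair, List.length_append]
    omega
  obtain ⟨y, rfl⟩ := hxp
  obtain ⟨z, hz⟩ := hxq
  rcases prefix_or_prefix_of_wordApp_eq hz with h | h
  · exact (aux hq hp h).symm
  · exact aux hp hq h

theorem IsLocalPair.evenAt_iff {g : Equiv.Perm CantorC} {p : BWord × BWord}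
    (hp : IsLocalPair g p) {x : CantorC} (hx : x ∈ cyl p.2) : EvenAt g x ↔ EvenPair p :=
  ⟨fun ⟨_, hq, hxq, he⟩ => (hq.evenPair_iff hp hxq hx).1 he, fun he => ⟨p, hp, hx, he⟩⟩

theorem IsLocalPair.inv {g : Equiv.Perm CantorC} {p : BWord × BWord}
    (hp : IsLocalPair g p) : IsLocalPair g⁻¹ p.swap := fun y => by
  rw [Equiv.Perm.inv_eq_iff_eq]
  exact (hp y).symm

theorem IsLocalPair.apply_mem {g : Equiv.Perm CantorC} {p : BWord × BWord}
    (hp : IsLocalPair g p) {x : CantorC} (hx : x ∈ cyl p.2) : g x ∈ cyl p.1 := by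
  obtain ⟨y, rfl⟩ := hx
  exact ⟨y, (hp y).symm⟩

/-- Local pairs compose, and their parities add up. -/
theorem IsLocalPair.exists_mul {f g : Equiv.Perm CantorC} {p q : BWord × BWord}
    (hp : IsLocalPair f p) (hq : IsLocalPair g q) {x : CantorC}
    (hxp : g x ∈ cyl p.2) (hxq : x ∈ cyl q.2) :
    ∃ r, IsLocalPair (f * g) r ∧ x ∈ cyl r.2 ∧ (EvenPair r ↔ (EvenPair p ↔ EvenPair q)) := by
  obtain ⟨a, b⟩ := p
  obtain ⟨c, d⟩ := q
  obtain ⟨y, rfl⟩ := hxq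
  obtain ⟨z, hz⟩ := hxp
  rw [hq y] at hz
  dsimp only at hz
  rcases prefix_or_prefix_of_wordApp_eq hz with ⟨w, rfl⟩ | ⟨w, rfl⟩
  · refine ⟨(a ++ w, d), fun t => ?_, ⟨y, rfl⟩, ?_⟩
    · rw [Equiv.Perm.mul_apply, hq t]
      exact hp.append w t
    · simp only [EvenPair, List.length_append]
      omega
  · refine ⟨(a, d ++ w), fun t => ?_, ⟨z, ?_⟩, ?_⟩
    · rw [Equiv.Perm.mul_apply, hq.append w t]
      exact hp t
    · rw [wordApp_append] at hz ⊢
      rw [wordApp_injective _ hz]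
    · simp only [EvenPair, List.length_append]
      omega

theorem IsLocallyPrefix.one : IsLocallyPrefix 1 := fun x =>
  ⟨([], []), fun _ => rfl, x, wordApp_nil x⟩

theorem IsLocallyPrefix.mul {f g : Equiv.Perm CantorC} (hf : IsLocallyPrefix f)
    (hg : IsLocallyPrefix g) : IsLocallyPrefix (f * g) := fun x => by
  obtain ⟨p, hp, hxp⟩ := hf (g x)
  obtain ⟨q, hq, hxq⟩ := hg x
  obtain ⟨r, hr, hxr, -⟩ := hp.exists_mul hq hxp hxq
  exact ⟨r, hr, hxr⟩

theorem IsLocallyPrefix.inv {g : Equiv.Perm CantorC} (hg : IsLocallyPrefix g) :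
    IsLocallyPrefix g⁻¹ := fun x => by
  obtain ⟨p, hp, hxp⟩ := hg (g⁻¹ x)
  exact ⟨p.swap, hp.inv, by simpa using hp.apply_mem hxp⟩

theorem EvenAt.one (x : CantorC) : EvenAt 1 x :=
  ⟨([], []), fun _ => rfl, ⟨x, wordApp_nil x⟩, rfl⟩

theorem evenAt_mul_iff {f g : Equiv.Perm CantorC} (hf : IsLocallyPrefix f)
    (hg : IsLocallyPrefix g) (x : CantorC) :
    EvenAt (f * g) x ↔ (EvenAt f (g x) ↔ EvenAt g x) := by
  obtain ⟨p, hp, hxp⟩ := hf (g x)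
  obtain ⟨q, hq, hxq⟩ := hg x
  obtain ⟨r, hr, hxr, h⟩ := hp.exists_mul hq hxp hxq
  rw [hr.evenAt_iff hxr, hp.evenAt_iff hxp, hq.evenAt_iff hxq, h]

theorem evenAt_inv_iff {g : Equiv.Perm CantorC} (hg : IsLocallyPrefix g) (x : CantorC) :
    EvenAt g⁻¹ x ↔ EvenAt g (g⁻¹ x) := by
  have h := evenAt_mul_iff hg hg.inv x
  rw [mul_inv_cancel] at h
  exact (h.1 (EvenAt.one x)).symm

theorem LexStrictMono.mul {f g : Equiv.Perm CantorC} (hf : LexStrictMono f)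
    (hg : LexStrictMono g) : LexStrictMono (f * g) := fun _ _ h => hf _ _ (hg _ _ h)

theorem LexStrictMono.lt_iff_lt {g : Equiv.Perm CantorC} (hg : LexStrictMono g)
    {x y : CantorC} : toLex (g x) < toLex (g y) ↔ toLex x < toLex y := by
  refine ⟨fun h => ?_, hg x y⟩
  rcases lt_trichotomy (toLex x) (toLex y) with h' | h' | h'
  · exact h'
  · rw [toLex.injective h'] at h
    exact absurd h (lt_irrefl _)
  · exact absurd h (hg _ _ h').asymm

theorem LexStrictMono.inv {g : Equiv.Perm CantorC} (hg : LexStrictMono g) :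
    LexStrictMono g⁻¹ := fun x y h => by
  rw [← hg.lt_iff_lt]
  simpa using h

theorem IsCodeFor.isLocallyPrefix {J : Finset (BWord × BWord)} {g : Equiv.Perm CantorC}
    (h : IsCodeFor J g) : IsLocallyPrefix g := fun x => by
  obtain ⟨p, ⟨hp, hxp⟩, -⟩ := h.1.2 x
  exact ⟨p, h.2.2 p hp, hxp⟩

theorem IsCodeFor.lexStrictMono {J : Finset (BWord × BWord)} {g : Equiv.Perm CantorC}
    (h : IsCodeFor J g) : LexStrictMono g := fun x y hxy => by
  obtain ⟨⟨hα, hβ⟩, hord, hind⟩ := h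
  obtain ⟨p, ⟨hp, x, rfl⟩, -⟩ := hβ x
  obtain ⟨q, ⟨hq, y, rfl⟩, -⟩ := hβ y
  rw [hind p hp, hind q hq]
  rcases eq_or_ne p q with rfl | hpq
  · rwa [toLex_wordApp_lt_wordApp_left] at hxy ⊢
  · rw [← lex_iff_toLex_wordApp_lt (not_prefix_of_existsUnique hβ hp hq hpq)
      (not_prefix_of_existsUnique hβ hq hp hpq.symm), ← hord p hp q hq] at hxy
    rwa [← lex_iff_toLex_wordApp_lt (not_prefix_of_existsUnique hα hp hq hpq)
      (not_prefix_of_existsUnique hα hq hp hpq.symm)]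

/-- By compactness, a locally prefix-replacing map does so on all cylinders of some depth. -/
theorem IsLocallyPrefix.exists_depth {g : Equiv.Perm CantorC} (hg : IsLocallyPrefix g) :
    ∃ N, ∀ w : BWord, w.length = N → ∃ a, IsLocalPair g (a, w) := by
  choose p hp hxp using hg
  obtain ⟨t, -, ht⟩ := isCompact_univ.elim_nhds_subcover (fun x => cyl (p x).2)
    fun x _ => (isOpen_cyl _).mem_nhds (hxp x)
  refine ⟨t.sup fun x => (p x).2.length, fun w hw => ?_⟩
  obtain ⟨x, hx, hwx⟩ := mem_iUnion₂.1 (ht (mem_univ (wordApp w fun _ => true)))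
  obtain ⟨y, hy⟩ := hwx
  have hle : (p x).2.length ≤ w.length :=
    hw ▸ Finset.le_sup (f := fun x => (p x).2.length) hx
  have hpre : (p x).2 <+: w := by
    rcases prefix_or_prefix_of_wordApp_eq hy with h | h
    · exact h
    · rw [h.eq_of_length (le_antisymm h.length_le hle)]
  obtain ⟨v, rfl⟩ := hpre
  exact ⟨_, (hp x).append v⟩

theorem IsLocallyPrefix.exists_isCodeFor {g : Equiv.Perm CantorC} (hg : IsLocallyPrefix g)
    (hmono : LexStrictMono g) : ∃ J, IsCodeFor J g := by
  classical
  obtain ⟨N, hN⟩ := hg.exists_depth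
  choose a ha using fun s : Fin N → Bool => hN (List.ofFn s) List.length_ofFn
  let J : Finset (BWord × BWord) := Finset.univ.image fun s : Fin N → Bool => (a s, List.ofFn s)
  have hind : InducedBy J g := fun p hp => by
    obtain ⟨s, -, rfl⟩ := Finset.mem_image.1 hp
    exact ha s
  have hβ : ∀ x : CantorC, ∃! p : BWord × BWord, p ∈ J ∧ x ∈ cyl p.2 := fun x => by
    refine ⟨(a fun i => x i, List.ofFn fun i : Fin N => x i),
      ⟨Finset.mem_image_of_mem _ (Finset.mem_univ _), _, wordApp_ofFn x N⟩, ?_⟩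
    rintro p ⟨hp, hx⟩
    obtain ⟨s, -, rfl⟩ := Finset.mem_image.1 hp
    obtain ⟨y, rfl⟩ := hx
    have : s = fun i : Fin N => wordApp (List.ofFn s) y i := by
      funext i
      simp [wordApp]
    rw [← this]
  have hα : ∀ x : CantorC, ∃! p : BWord × BWord, p ∈ J ∧ x ∈ cyl p.1 := fun x => by
    have key : ∀ p ∈ J, x ∈ cyl p.1 ↔ g⁻¹ x ∈ cyl p.2 := fun p hp =>
      ⟨fun h => IsLocalPair.apply_mem (IsLocalPair.inv (hind p hp)) h,
        fun h => by simpa using IsLocalPair.apply_mem (hind p hp) h⟩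
    refine (existsUnique_congr fun p => and_congr_right fun hp => key p hp).2 (hβ (g⁻¹ x))
  refine ⟨J, ⟨hα, hβ⟩, fun p hp q hq => ?_, hind⟩
  rcases eq_or_ne p q with rfl | hpq
  · exact iff_of_false (List.lex_irrefl lt_irrefl _) (List.lex_irrefl lt_irrefl _)
  · let x : CantorC := fun _ => true
    rw [lex_iff_toLex_wordApp_lt (not_prefix_of_existsUnique hα hp hq hpq)
        (not_prefix_of_existsUnique hα hq hp hpq.symm) x x,
      lex_iff_toLex_wordApp_lt (not_prefix_of_existsUnique hβ hp hq hpq)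
        (not_prefix_of_existsUnique hβ hq hp hpq.symm) x x,
      ← hind p hp, ← hind q hq, hmono.lt_iff_lt]

theorem inF_iff {g : Equiv.Perm CantorC} : InF g ↔ IsLocallyPrefix g ∧ LexStrictMono g :=
  ⟨fun ⟨_, h⟩ => ⟨h.isLocallyPrefix, h.lexStrictMono⟩, fun h => h.1.exists_isCodeFor h.2⟩

theorem inF_one : InF 1 := inF_iff.2 ⟨IsLocallyPrefix.one, fun _ _ h => h⟩

theorem InF.mul {f g : Equiv.Perm CantorC} (hf : InF f) (hg : InF g) : InF (f * g) := by
  rw [inF_iff] at *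
  exact ⟨hf.1.mul hg.1, hf.2.mul hg.2⟩

theorem InF.inv {g : Equiv.Perm CantorC} (hg : InF g) : InF g⁻¹ := by
  rw [inF_iff] at *
  exact ⟨hg.1.inv, hg.2.inv⟩

theorem inH2_iff {g : Equiv.Perm CantorC} : InH2 g ↔ InF g ∧ ∀ x, EvenAt g x := by
  constructor
  · rintro ⟨J, hJ, he⟩
    refine ⟨⟨J, hJ⟩, fun x => ?_⟩
    obtain ⟨p, ⟨hp, hxp⟩, -⟩ := hJ.1.2 x
    exact ⟨p, hJ.2.2 p hp, hxp, he p hp⟩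
  · rintro ⟨⟨J, hJ⟩, he⟩
    exact ⟨J, hJ, fun p hp => (IsLocalPair.evenAt_iff (hJ.2.2 p hp) ⟨fun _ => true, rfl⟩).1 (he _)⟩

theorem inH2_one : InH2 1 := inH2_iff.2 ⟨inF_one, EvenAt.one⟩

theorem InH2.mul {f g : Equiv.Perm CantorC} (hf : InH2 f) (hg : InH2 g) : InH2 (f * g) := by
  rw [inH2_iff] at *
  refine ⟨hf.1.mul hg.1, fun x => ?_⟩
  rw [evenAt_mul_iff (inF_iff.1 hf.1).1 (inF_iff.1 hg.1).1]
  exact iff_of_true (hf.2 _) (hg.2 x)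

theorem InH2.inv {g : Equiv.Perm CantorC} (hg : InH2 g) : InH2 g⁻¹ := by
  rw [inH2_iff] at *
  refine ⟨hg.1.inv, fun x => ?_⟩
  rw [evenAt_inv_iff (inF_iff.1 hg.1).1]
  exact hg.2 _

theorem mem_pF_iff {g : Equiv.Perm CantorC} (hg : InF g) (z : CantorC) :
    z ∈ pF g ↔ EvenAt g (g⁻¹ z) := by
  simp only [pF, pSet, mem_iUnion, mem_ofPred_eq, exists_prop]
  constructor
  · rintro ⟨J, hJ, p, hp, he, hz⟩
    exact ⟨p, hJ.2.2 p hp, IsLocalPair.apply_mem (IsLocalPair.inv (hJ.2.2 p hp)) hz, he⟩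
  · intro h
    obtain ⟨J, hJ⟩ := hg
    obtain ⟨p, ⟨hp, hxp⟩, -⟩ := hJ.1.2 (g⁻¹ z)
    have hl : IsLocalPair g p := hJ.2.2 p hp
    exact ⟨J, hJ, p, hp, (hl.evenAt_iff hxp).1 h, by simpa using hl.apply_mem hxp⟩

theorem inH2_inv_mul_iff {f g : Equiv.Perm CantorC} (hf : InF f) (hg : InF g) :
    InH2 (f⁻¹ * g) ↔ pF f = pF g := by
  have hf' := (inF_iff.1 hf).1
  rw [inH2_iff, and_iff_right (hf.inv.mul hg), Set.ext_iff,
    ← g.forall_congr_right (q := fun z => z ∈ pF f ↔ z ∈ pF g)]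
  refine forall_congr' fun x => ?_
  rw [evenAt_mul_iff hf'.inv (inF_iff.1 hg).1, evenAt_inv_iff hf', mem_pF_iff hf, mem_pF_iff hg]
  simp

theorem mem_FGrp_iff {g : Equiv.Perm CantorC} : g ∈ FGrp ↔ InF g := by
  refine ⟨fun h => ?_, fun h => Subgroup.subset_closure h⟩
  induction h using Subgroup.closure_induction with
  | mem x hx => exact hx
  | one => exact inF_one
  | mul x y _ _ hx hy => exact hx.mul hy
  | inv x _ hx => exact hx.inv

theorem mem_H2Sub_iff {g : FGrp} : g ∈ H2Sub ↔ InH2 (g : Equiv.Perm CantorC) := by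
  refine ⟨fun h => ?_, fun h => Subgroup.subset_closure h⟩
  induction h using Subgroup.closure_induction with
  | mem x hx => exact hx
  | one => exact inH2_one
  | mul x y _ _ hx hy => exact hx.mul hy
  | inv x _ hx => exact hx.inv

/-- `f⁻¹ ∘ g ∈ H₂ ↔ p_f = p_g`, and `[f] ↦ p_f` is a well-defined
bijection from `F/H₂` onto `Ω₂`. -/
theorem stmt5 :
    (∀ f g : Equiv.Perm CantorC, InF f → InF g → (InH2 (f⁻¹ * g) ↔ pF f = pF g)) ∧
    ∃ b : FGrp ⧸ H2Sub → Set CantorC,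
      (∀ f : FGrp, b (QuotientGroup.mk f) = pF (f : Equiv.Perm CantorC)) ∧
      Function.Injective b ∧ Set.range b = Omega2 := by
  have key : ∀ f g : FGrp, f⁻¹ * g ∈ H2Sub ↔ pF (f : Equiv.Perm CantorC) = pF g := fun f g => by
    rw [mem_H2Sub_iff]
    exact inH2_inv_mul_iff (mem_FGrp_iff.1 f.2) (mem_FGrp_iff.1 g.2)
  refine ⟨fun f g hf hg => inH2_inv_mul_iff hf hg,
    Quotient.lift (fun f : FGrp => pF (f : Equiv.Perm CantorC)) fun f g h =>
      (key f g).1 (QuotientGroup.leftRel_apply.1 h), fun f => rfl, ?_, ?_⟩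
  · rintro ⟨f⟩ ⟨g⟩ h
    exact QuotientGroup.eq.2 ((key f g).2 h)
  · ext s
    constructor
    · rintro ⟨⟨f⟩, rfl⟩
      exact ⟨f, mem_FGrp_iff.1 f.2, rfl⟩
    · rintro ⟨g, hg, rfl⟩
      exact ⟨QuotientGroup.mk ⟨g, mem_FGrp_iff.2 hg⟩, rfl⟩
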